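/- arXiv:0810.5032 — 3 statements merged into one kernel-verified Lean document; each statement's English description precedes it below -/
import Mathlib

section
/- Let p be a prime, n ≥ 1 and m ≥ 1, let ℤ_p denote the ring of p-adic integers, let R = MvPolynomial (Fin n) ℤ_p = ℤ_p[v_1,…,v_n], let M = R/(p, v_1, …, v_{n−1}, v_n^{m+1}) be the quotient of R by the ideal generated by p, the first n − 1 variables, and the (m+1)-st power of the last variable, and let k = ZMod p be regarded as an R-module via the ring homomorphism R → ZMod p sending each variable v_i to 0 and reducing constants modulo p. Then for every j ≥ 0, the abelian group Tor_j^R(M, k) has cardinality p^(binom(n+1, j)). (This is the additive content of the paper's computation H_*^{BP⟨n⟩_p}(P_{mq} k(n); 𝔽_p) ≅ Λ_{𝔽_p}(α_0,…,α_{n−1}, a_{m+1}), an exterior algebra on n + 1 generators, using that P_{mq} k(n) = BP⟨n⟩_p/(p, v_1, …, v_{n−1}, v_n^{m+1}).) -/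
open CategoryTheory
open MonoidalCategory

open scoped TensorProduct
universe u
section aux
variable {R : Type u} [CommRing R]

lemma card_of_exact {A B C : Type*} [AddCommGroup A] [AddCommGroup B] [AddCommGroup C]
    [Module R A] [Module R B] [Module R C] (f : A →ₗ[R] B) (g : B →ₗ[R] C)
    (hf : Function.Injective f) (hg : Function.Surjective g) (h : Function.Exact f g) :
    Nat.card B = Nat.card A * Nat.card C := by
  have e1 := Submodule.card_eq_card_quotient_mul_card (LinearMap.ker g)
  have e2 := Nat.card_congr (g.quotKerEquivOfSurjective hg).toEquiv
  have e3 := Nat.card_congr (LinearEquiv.ofInjective f hf).toEquiv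
  rw [LinearMap.exact_iff.mp h] at e1 e2
  rw [e1, e3, ← e2, mul_comm]

/-- the complex `N ⊗ P`. -/
noncomputable abbrev tc (N : ModuleCat.{u} R) (P : ChainComplex (ModuleCat.{u} R) ℕ) :
    ChainComplex (ModuleCat.{u} R) ℕ :=
  (((tensoringLeft (ModuleCat.{u} R)).obj N).mapHomologicalComplex _).obj P

noncomputable abbrev tcMap {N N' : ModuleCat.{u} R} (f : N ⟶ N')
    (P : ChainComplex (ModuleCat.{u} R) ℕ) : tc N P ⟶ tc N' P :=
  (NatTrans.mapHomologicalComplex ((tensoringLeft (ModuleCat.{u} R)).map f) _).app P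

lemma card_tor {N k : ModuleCat.{u} R} (P : ProjectiveResolution k) (j : ℕ) :
    Nat.card (((Tor (ModuleCat.{u} R) j).obj N).obj k) = Nat.card ((tc N P.complex).homology j) :=
  Nat.card_congr (P.isoLeftDerivedObj ((tensoringLeft (ModuleCat.{u} R)).obj N) j).toLinearEquiv.toEquiv

lemma flat_res {k : ModuleCat.{u} R} (P : ProjectiveResolution k) (i : ℕ) :
    Module.Flat R (P.complex.X i) := by
  have := P.projective i
  have : Module.Projective R (P.complex.X i) := by
    rwa [IsProjective.iff_projective]
  infer_instance

lemma homologyMap_zero {N k : ModuleCat.{u} R} (P : ProjectiveResolution k) (x : R)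
    (hx : ∀ a : k, x • a = 0) (f : N ⟶ N) (hf : ∀ a, f a = x • a) (j : ℕ) :
    HomologicalComplex.homologyMap (tcMap f P.complex) j = 0 := by
  have h0 : (x • 𝟙 P.complex) ≫ P.π = 0 := by
    apply HomologicalComplex.hom_ext
    intro i
    rcases i with _ | i
    · ext a
      obtain ⟨e⟩ : Nonempty (((ChainComplex.single₀ (ModuleCat.{u} R)).obj k).X 0 ≅ k) := ⟨Iso.refl _⟩
      have : x • (P.π.f 0 a) = 0 := by
        apply e.toLinearEquiv.injective
        rw [map_smul, map_zero]
        exact hx _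
      refine Eq.trans ?_ this
      rw [← map_smul]
      rfl
    · exact (HomologicalComplex.isZero_single_obj_X _ _ _ _ (by simp)).eq_of_tgt _ _
  have h1 : Homotopy (x • 𝟙 P.complex) 0 := ProjectiveResolution.liftHomotopyZero _ h0
  have h2 := ((tensoringLeft (ModuleCat.{u} R)).obj N).mapHomotopy h1
  have h3 := h2.homologyMap_eq j
  have h4 : tcMap f P.complex = (((tensoringLeft (ModuleCat.{u} R)).obj N).mapHomologicalComplex _).map (x • 𝟙 P.complex) := by
    apply HomologicalComplex.hom_ext
    intro i
    apply ModuleCat.hom_ext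
    apply TensorProduct.ext'
    intro a b
    change (f a) ⊗ₜ[R] b = a ⊗ₜ[R] (x • b)
    rw [hf, TensorProduct.smul_tmul]
  rw [h4]
  refine h3.trans ?_
  simp

noncomputable def tses (S : ShortComplex (ModuleCat.{u} R)) (P : ChainComplex (ModuleCat.{u} R) ℕ) :
    ShortComplex (ChainComplex (ModuleCat.{u} R) ℕ) :=
  ShortComplex.mk (tcMap S.f P) (tcMap S.g P) (by
    ext i : 1
    have := congrArg (fun t => t ▷ P.X i) S.zero
    simp only [comp_whiskerRight, MonoidalPreadditive.zero_whiskerRight] at this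
    exact this)

lemma tses_exact (S : ShortComplex (ModuleCat.{u} R)) (hS : S.ShortExact) {k : ModuleCat.{u} R}
    (P : ProjectiveResolution k) : (tses S P.complex).ShortExact := by
  apply HomologicalComplex.shortExact_of_degreewise_shortExact
  intro i
  have := flat_res P i
  exact hS.map_of_exact (tensorRight (P.complex.X i))

lemma tor_step' {N N' k : ModuleCat.{u} R} (f : N ⟶ N) (g : N ⟶ N') (w : f ≫ g = 0)
    (hS : (ShortComplex.mk f g w).ShortExact) (x : R)
    (hx : ∀ a : k, x • a = 0) (hf : ∀ a, f a = x • a) :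
    Nat.card (((Tor (ModuleCat.{u} R) 0).obj N').obj k) =
      Nat.card (((Tor (ModuleCat.{u} R) 0).obj N).obj k) ∧
    ∀ j, Nat.card (((Tor (ModuleCat.{u} R) (j+1)).obj N').obj k) =
      Nat.card (((Tor (ModuleCat.{u} R) (j+1)).obj N).obj k) *
      Nat.card (((Tor (ModuleCat.{u} R) j).obj N).obj k) := by
  let P := projectiveResolution k
  simp only [card_tor P]
  have hT := tses_exact _ hS P
  have hz : ∀ j, HomologicalComplex.homologyMap (tses (ShortComplex.mk f g w) P.complex).f j = 0 :=
    homologyMap_zero P x hx f hf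
  have inj : ∀ j, Function.Injective (HomologicalComplex.homologyMap (tses (ShortComplex.mk f g w) P.complex).g j) := by
    intro j
    rw [← ModuleCat.mono_iff_injective]
    exact (hT.homology_exact₂ j).mono_g (hz j)
  constructor
  · have : Epi (HomologicalComplex.homologyMap (tses (ShortComplex.mk f g w) P.complex).g 0) := by
      have := hT.epi_g
      exact HomologicalComplex.epi_homologyMap_of_epi_of_not_rel _ 0 (by simp)
    have hs := (ModuleCat.epi_iff_surjective _).1 this
    exact (Nat.card_congr (Equiv.ofBijective _ ⟨inj 0, hs⟩)).symm
  · intro j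
    refine card_of_exact (R := R) (HomologicalComplex.homologyMap (tses (ShortComplex.mk f g w) P.complex).g (j+1)).hom
      (hT.δ (j+1) j (by simp)).hom (inj _) ?_ ?_
    · have := (hT.homology_exact₁ (j+1) j (by simp)).epi_f (hz j)
      exact (ModuleCat.epi_iff_surjective _).1 this
    · exact (ShortComplex.ShortExact.moduleCat_exact_iff_function_exact _).1 (hT.homology_exact₃ (j+1) j (by simp))

lemma tor_ideal_step {k : ModuleCat.{u} R} (I J : Ideal R) (x : R) (hJ : J = I ⊔ Ideal.span {x})
    (hI : ∀ a, x * a ∈ I → a ∈ I) (hx : ∀ a : k, x • a = 0) (l : ℕ) (q : ℕ)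
    (h : ∀ j, Nat.card (((Tor (ModuleCat.{u} R) j).obj (ModuleCat.of R (R ⧸ I))).obj k) =
      q ^ (l.choose j)) (j : ℕ) :
    Nat.card (((Tor (ModuleCat.{u} R) j).obj (ModuleCat.of R (R ⧸ J))).obj k) =
      q ^ ((l+1).choose j) := by
  have hIJ : I ≤ J := hJ ▸ le_sup_left
  have hxJ : x ∈ J := hJ ▸ Ideal.mem_sup_right (Ideal.mem_span_singleton_self x)
  let f : (R ⧸ I) →ₗ[R] (R ⧸ I) := LinearMap.lsmul R (R ⧸ I) x
  let g : (R ⧸ I) →ₗ[R] (R ⧸ J) := Submodule.mapQ I J LinearMap.id hIJ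
  have hg : ∀ a, g (Submodule.Quotient.mk a) = Submodule.Quotient.mk a := fun a => rfl
  have hf : ∀ a, f (Submodule.Quotient.mk a) = Submodule.Quotient.mk (x * a) := fun a => rfl
  have ex : Function.Exact f g := by
    intro b
    obtain ⟨b, rfl⟩ := Submodule.Quotient.mk_surjective _ b
    rw [hg, Submodule.Quotient.mk_eq_zero]
    constructor
    · intro hb
      rw [hJ] at hb
      obtain ⟨i, hi, y, hy, rfl⟩ := Submodule.mem_sup.1 hb
      obtain ⟨c, rfl⟩ := Ideal.mem_span_singleton'.1 hy
      refine ⟨Submodule.Quotient.mk c, ?_⟩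
      rw [hf, Submodule.Quotient.eq]
      convert I.neg_mem hi using 1
      ring
    · rintro ⟨c, hc⟩
      obtain ⟨c, rfl⟩ := Submodule.Quotient.mk_surjective _ c
      rw [hf, Submodule.Quotient.eq] at hc
      have := J.sub_mem (J.mul_mem_right c hxJ) (hIJ hc)
      simpa using this
  have inj : Function.Injective f := by
    rw [injective_iff_map_eq_zero]
    intro a ha
    obtain ⟨a, rfl⟩ := Submodule.Quotient.mk_surjective _ a
    rw [hf, Submodule.Quotient.mk_eq_zero] at ha
    exact (Submodule.Quotient.mk_eq_zero _).2 (hI a ha)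
  have surj : Function.Surjective g := by
    intro b
    obtain ⟨b, rfl⟩ := Submodule.Quotient.mk_surjective _ b
    exact ⟨Submodule.Quotient.mk b, rfl⟩
  have w : ModuleCat.ofHom f ≫ ModuleCat.ofHom g = 0 :=
    ModuleCat.hom_ext (LinearMap.ext ex.apply_apply_eq_zero)
  have hS : (ShortComplex.mk (ModuleCat.ofHom f) (ModuleCat.ofHom g) w).ShortExact :=
    { exact := (ShortComplex.ShortExact.moduleCat_exact_iff_function_exact _).2 ex
      mono_f := (ModuleCat.mono_iff_injective _).2 inj
      epi_g := (ModuleCat.epi_iff_surjective _).2 surj }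
  obtain ⟨h0, h1⟩ := tor_step' (k := k) _ _ w hS x hx (fun a => rfl)
  rcases j with _ | j
  · rw [h0, h]; simp
  · rw [h1, h, h, Nat.choose_succ_succ, pow_add, mul_comm]

lemma tor_base {N k : ModuleCat.{u} R} [Module.Flat R N] (j : ℕ) :
    Nat.card (((Tor (ModuleCat.{u} R) (j+1)).obj N).obj k) = 1 := by
  let P := projectiveResolution k
  rw [card_tor P]
  have h := P.exact_succ j
  have h2 := Module.Flat.lTensor_shortComplex_exact N _ h
  have h3 : (tc N P.complex).ExactAt (j+1) := by
    rw [HomologicalComplex.exactAt_iff' _ (j+2) (j+1) j (by simp) (by simp)]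
    exact h2
  have := ModuleCat.subsingleton_of_isZero h3.isZero_homology
  exact Nat.card_of_subsingleton 0

lemma tor_zero {N k : ModuleCat.{u} R} (e : N ≃ₗ[R] R) :
    Nat.card (((Tor (ModuleCat.{u} R) 0).obj N).obj k) = Nat.card k := by
  have e1 := (((tensoringLeft (ModuleCat.{u} R)).obj N).leftDerivedZeroIsoSelf.app k).toLinearEquiv
  refine (Nat.card_congr e1.toEquiv).trans ?_
  exact Nat.card_congr ((TensorProduct.congr e (LinearEquiv.refl R k)).trans (TensorProduct.lid R k)).toEquiv

end aux

section poly
open MvPolynomial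
variable {σ A : Type*} [CommRing A]

lemma reg_monomial (s : Set (σ →₀ ℕ)) (i : σ) (e : ℕ) (hs : ∀ t ∈ s, t i = 0)
    (a : MvPolynomial σ A)
    (h : X i ^ e * a ∈ Ideal.span ((fun t => monomial t (1 : A)) '' s)) :
    a ∈ Ideal.span ((fun t => monomial t (1 : A)) '' s) := by
  rw [mem_ideal_span_monomial_image] at h ⊢
  intro xi hxi
  obtain ⟨t, ht, hle⟩ := h (Finsupp.single i e + xi) (by
    rw [mem_support_iff, X_pow_eq_monomial, coeff_monomial_mul]
    simpa using hxi)
  refine ⟨t, ht, fun u => ?_⟩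
  have := hle u
  by_cases hu : i = u
  · subst hu; simp [hs t ht]
  · simpa [Finsupp.single_apply, hu] using this

lemma reg_const [IsDomain A] (s : Set (σ →₀ ℕ)) (c : A) (hc : c ≠ 0)
    (a : MvPolynomial σ A)
    (h : C c * a ∈ Ideal.span ((fun t => monomial t (1 : A)) '' s)) :
    a ∈ Ideal.span ((fun t => monomial t (1 : A)) '' s) := by
  rw [mem_ideal_span_monomial_image] at h ⊢
  intro xi hxi
  refine h xi ?_
  rw [mem_support_iff, coeff_C_mul]
  exact mul_ne_zero hc (by simpa using hxi)

end poly

/-- For `R = ℤ_p[v_1, …, v_n]`, `M = R/(p, v_1, …, v_{n-1}, v_n^(m+1))` and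
`k = 𝔽_p` an `R`-module via the augmentation, `Tor_j^R(M, k)` has cardinality
`p ^ (binom (n+1) j)`. -/
theorem stmt_3 (p : ℕ) [Fact p.Prime] (n m : ℕ) (hn : 1 ≤ n) (hm : 1 ≤ m) (j : ℕ) :
    letI : Module (MvPolynomial (Fin n) ℤ_[p]) (ZMod p) :=
      (MvPolynomial.eval₂Hom (PadicInt.toZMod (p := p)) (fun _ => 0)).toModule
    Nat.card
        (((Tor (ModuleCat (MvPolynomial (Fin n) ℤ_[p])) j).obj
          (ModuleCat.of _
            (MvPolynomial (Fin n) ℤ_[p] ⧸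
              Ideal.span ({(p : MvPolynomial (Fin n) ℤ_[p])} ∪
                (MvPolynomial.X '' {i : Fin n | (i : ℕ) < n - 1}) ∪
                {(MvPolynomial.X (⟨n - 1, by omega⟩ : Fin n) :
                    MvPolynomial (Fin n) ℤ_[p]) ^ (m + 1)})))).obj
          (ModuleCat.of _ (ZMod p))) =
      p ^ (n + 1).choose j := by
  
  let _ : Module (MvPolynomial (Fin n) ℤ_[p]) (ZMod p) :=
      (MvPolynomial.eval₂Hom (PadicInt.toZMod (p := p)) (fun _ => 0)).toModule
  set k := ModuleCat.of (MvPolynomial (Fin n) ℤ_[p]) (ZMod p) with hk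
  have hX : ∀ (i : Fin n) (e : ℕ) (a : k),
      ((MvPolynomial.X i : MvPolynomial (Fin n) ℤ_[p]) ^ (e+1)) • a = 0 := by
    intro i e a
    change (MvPolynomial.eval₂Hom (PadicInt.toZMod (p := p)) (fun _ => 0)) (MvPolynomial.X i ^ (e+1)) * (show ZMod p from a) = 0
    simp
  have hp : ∀ a : k, (MvPolynomial.C (p : ℤ_[p]) : MvPolynomial (Fin n) ℤ_[p]) • a = 0 := by
    intro a
    change (MvPolynomial.eval₂Hom (PadicInt.toZMod (p := p)) (fun _ => 0)) (MvPolynomial.C (p : ℤ_[p])) * (show ZMod p from a) = 0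
    simp
  -- the ideals generated by the first `i` variables
  let s : ℕ → Set (Fin n →₀ ℕ) := fun i => (fun j => Finsupp.single j 1) '' {j : Fin n | (j : ℕ) < i}
  let I : Set (Fin n →₀ ℕ) → Ideal (MvPolynomial (Fin n) ℤ_[p]) :=
    fun s => Ideal.span ((fun t => MvPolynomial.monomial t 1) '' s)
  have hvars : ∀ i, i ≤ n - 1 → ∀ j,
      Nat.card (((Tor (ModuleCat (MvPolynomial (Fin n) ℤ_[p])) j).obj
        (ModuleCat.of _ (MvPolynomial (Fin n) ℤ_[p] ⧸ I (s i)))).obj k) = p ^ (i.choose j) := by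
    intro i
    induction i with
    | zero =>
      intro _ j
      have hbot : I (s 0) = ⊥ := by simp [I, s]
      let e := Submodule.quotEquivOfEqBot (I (s 0)) hbot
      rcases j with _ | j
      · rw [tor_zero (N := ModuleCat.of (MvPolynomial (Fin n) ℤ_[p]) (MvPolynomial (Fin n) ℤ_[p] ⧸ I (s 0))) e]
        simp [hk]
      · have : Module.Flat (MvPolynomial (Fin n) ℤ_[p])
          (ModuleCat.of (MvPolynomial (Fin n) ℤ_[p]) (MvPolynomial (Fin n) ℤ_[p] ⧸ I (s 0))) := Module.Flat.of_linearEquiv e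
        rw [tor_base]
        simp
    | succ i ih =>
      intro hi j
      refine tor_ideal_step (I (s i)) (I (s (i+1))) (MvPolynomial.X ⟨i, by omega⟩ ^ (0+1)) ?_ ?_
        (hX _ _) i p (ih (by omega)) j
      · rw [← Ideal.span_union]
        refine congrArg Ideal.span ?_
        ext f
        simp only [s, Set.image_image, Set.mem_union, Set.mem_image, Set.mem_ofPred_eq, Set.mem_singleton_iff]
        constructor
        · rintro ⟨x, hx, rfl⟩
          rcases Nat.lt_succ_iff_lt_or_eq.1 hx with h | h
          · exact Or.inl ⟨x, h, rfl⟩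
          · right
            subst h
            simp [MvPolynomial.X]
        · rintro (⟨x, hx, rfl⟩ | rfl)
          · exact ⟨x, by omega, rfl⟩
          · exact ⟨⟨i, by omega⟩, by simp, by simp [MvPolynomial.X]⟩
      · refine reg_monomial _ _ _ ?_
        rintro _ ⟨y, hy, rfl⟩
        simp only [Set.mem_ofPred_eq] at hy
        rw [Finsupp.single_apply, if_neg]
        rintro rfl
        simp at hy
  let t : Set (Fin n →₀ ℕ) := s (n-1) ∪ {Finsupp.single ⟨n - 1, by omega⟩ (m+1)}
  have h1 := tor_ideal_step (I (s (n-1))) (I t) (MvPolynomial.X ⟨n - 1, by omega⟩ ^ (m+1)) (by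
      rw [← Ideal.span_union]
      simp only [I, t, Set.image_union, Set.image_singleton, MvPolynomial.X_pow_eq_monomial]) (by
      refine reg_monomial _ _ _ ?_
      rintro _ ⟨y, hy, rfl⟩
      simp only [Set.mem_ofPred_eq] at hy
      rw [Finsupp.single_apply, if_neg]
      rintro rfl
      simp at hy) (hX _ _) (n-1) p (hvars _ le_rfl)
  have h2 := fun J hJ => tor_ideal_step (I t) J (MvPolynomial.C (p : ℤ_[p])) hJ
    (reg_const t _ (by exact_mod_cast (Fact.out : p.Prime).ne_zero)) hp _ p h1 j
  have hn' : n - 1 + 1 + 1 = n + 1 := by omega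
  rw [hn'] at h2
  apply h2
  rw [← Ideal.span_union]
  refine congrArg Ideal.span ?_
  simp only [t, s, Set.image_union, Set.image_singleton, MvPolynomial.X_pow_eq_monomial, Set.image_image]
  rw [map_natCast, Set.union_comm _ {(p : MvPolynomial (Fin n) ℤ_[p])}, ← Set.union_assoc]
  rfl
end

section
/- Let p be a prime and N ≥ 1, let V be the 𝔽_p-vector space Fin N → ZMod p, and let Λ = ExteriorAlgebra (ZMod p) V be the exterior algebra on V over 𝔽_p (so the generators square to zero and anticommute). Regard k = ZMod p as a left Λ-module via the augmentation Λ → ZMod p that kills V. Then for every m ≥ 0, the abelian group Ext^m_Λ(k, k), computed in the abelian category of left Λ-modules, has cardinality p^(binom(m + N − 1, N − 1)), i.e. Ext^*_Λ(k, k) has the size of a polynomial algebra over 𝔽_p on N generators, one in each cohomological degree contributing binom(m+N−1, N−1) monomials in degree m. (This Koszul-duality computation is the identification, used throughout the paper, of the E_2-term of the topological Hochschild cohomology spectral sequence Ext_{H_*^R(A;𝔽_p)}(𝔽_p, 𝔽_p) ⇒ π_* THH_R(A; H𝔽_p) as a polynomial algebra 𝔽_p[q_0, …, q_{N−1}] on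 Bockstein classes whenever H_*^R(A;𝔽_p) is an exterior algebra on N generators, e.g. THH^*_{BP⟨n⟩_p}(H𝔽_p; H𝔽_p) ≅ 𝔽_p[q_0,…,q_n] with N = n + 1 and THH^*_{BP⟨n⟩_p}(k(n); H𝔽_p) ≅ 𝔽_p[q_0,…,q_{n−1}] with N = n.) -/
open CategoryTheory


namespace Koszul

section Abstract
variable {N : ℕ} {A : Type} [Ring A] (x : Fin N → A)

/-- Koszul differential on all functions of multisets. -/
def D (F : Multiset (Fin N) → A) (s : Multiset (Fin N)) : A := ∑ i, F (i ::ₘ s) * x i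

lemma D_D (hx : ∀ i, x i * x i = 0) (hxx : ∀ i j, x i * x j + x j * x i = 0)
    (F : Multiset (Fin N) → A) : D x (D x F) = 0 := by
  funext s
  simp only [D, Finset.sum_mul, Pi.zero_apply, mul_assoc]
  rw [← Finset.sum_product']
  refine Finset.sum_involution (fun a _ => (a.2, a.1)) ?_ ?_ ?_ ?_
  · rintro ⟨i, j⟩ -
    simp only
    rw [Multiset.cons_swap i j s, ← mul_add, hxx, mul_zero]
  · rintro ⟨i, j⟩ - h heq
    simp only [Prod.mk.injEq] at heq
    obtain ⟨h1, h2⟩ := heq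
    subst h1
    simp [hx] at h
  · simp
  · simp

/-- homotopy -/
def H (c : Fin N → A →+ A) (j : Fin N) (F : Multiset (Fin N) → A) (s : Multiset (Fin N)) : A :=
  if j ∈ s then c j (F (s.erase j)) else 0

lemma homotopy (c : Fin N → A →+ A)
    (hc : ∀ i j b, c j (b * x i) = (if i = j then b else 0) - c j b * x i)
    (j : Fin N) (F : Multiset (Fin N) → A) (s : Multiset (Fin N)) :
    D x (H c j F) s + H c j (D x F) s = if j ∈ s then F s else c j (F s) * x j := by
  have key : ∀ i, H c j F (i ::ₘ s) * x i + (if j ∈ s then c j (F (i ::ₘ s.erase j) * x i) else 0)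
      = if i = j then (if j ∈ s then F s else c j (F s) * x j) else 0 := by
    intro i
    by_cases hij : i = j
    · subst hij
      by_cases hs : i ∈ s
      · simp [H, hs, hc]
      · simp [H, hs]
    · by_cases hs : j ∈ s
      · simp [H, hs, hc, hij, Multiset.erase_cons_tail s hij]
      · simp [H, hs, hij, Ne.symm hij]
  have h2 : H c j (D x F) s = ∑ i, (if j ∈ s then c j (F (i ::ₘ s.erase j) * x i) else 0) := by
    unfold H D
    split_ifs <;> simp
  rw [h2]
  unfold D
  rw [← Finset.sum_add_distrib, Finset.sum_congr rfl (fun i _ => key i)]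
  simp

lemma D_add (F G : Multiset (Fin N) → A) : D x (F + G) = D x F + D x G := by
  funext s; simp [D, add_mul, Finset.sum_add_distrib]

lemma D_sub (F G : Multiset (Fin N) → A) : D x (F - G) = D x F - D x G := by
  funext s; simp [D, sub_mul, Finset.sum_sub_distrib]

lemma exact_total (hx : ∀ i, x i * x i = 0) (hxx : ∀ i j, x i * x j + x j * x i = 0)
    (c : Fin N → A →+ A)
    (hc : ∀ i j b, c j (b * x i) = (if i = j then b else 0) - c j b * x i)
    (F : Multiset (Fin N) → A) (hF : D x F = 0) (h0 : F 0 = 0) : ∃ G, D x G = F := by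
  have main : ∀ T : Finset (Fin N), ∃ G, ∀ s, (F s = 0 ∨ ∃ j ∈ T, j ∈ s) → D x G s = F s := by
    intro T
    induction T using Finset.induction_on with
    | empty =>
      refine ⟨0, fun s hs => ?_⟩
      rcases hs with hs | ⟨j, hj, -⟩
      · rw [hs]; simp [D]
      · simp at hj
    | insert j T _ ih =>
      obtain ⟨G, hG⟩ := ih
      set E := F - D x G with hE
      have hDE : D x E = 0 := by rw [hE, D_sub, hF, D_D x hx hxx, sub_zero]
      refine ⟨G + H c j E, fun s hs => ?_⟩
      have hh := homotopy x c hc j E s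
      have hz : H c j (D x E) s = 0 := by rw [hDE]; simp [H]
      rw [hz, add_zero] at hh
      rw [D_add, Pi.add_apply, hh]
      have hEs : E s = F s - D x G s := rfl
      by_cases hj : j ∈ s
      · simp [hj, hEs]
      · have : D x G s = F s := by
          apply hG
          rcases hs with hs | ⟨i, hi, his⟩
          · exact Or.inl hs
          · rcases Finset.mem_insert.1 hi with rfl | hi
            · exact absurd his hj
            · exact Or.inr ⟨i, hi, his⟩
        simp [hj, hEs, this]
  obtain ⟨G, hG⟩ := main Finset.univ
  refine ⟨G, funext fun s => hG s ?_⟩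
  rcases Multiset.empty_or_exists_mem s with rfl | ⟨j, hj⟩
  · exact Or.inl h0
  · exact Or.inr ⟨j, Finset.mem_univ _, hj⟩

/-- The Koszul differential. -/
def d (n : ℕ) : (Sym (Fin N) (n+1) → A) →ₗ[A] (Sym (Fin N) n → A) where
  toFun f s := ∑ i, f (i ::ₛ s) * x i
  map_add' f g := by funext s; simp [add_mul, Finset.sum_add_distrib]
  map_smul' a f := by funext s; simp [mul_assoc, Finset.mul_sum]

/-- extension by zero -/
def ext (n : ℕ) (f : Sym (Fin N) n → A) (s : Multiset (Fin N)) : A :=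
  if h : s.card = n then f ⟨s, h⟩ else 0

lemma ext_coe (n : ℕ) (f : Sym (Fin N) n → A) (s : Sym (Fin N) n) : ext n f s.1 = f s :=
  dif_pos s.2

lemma D_ext (n : ℕ) (f : Sym (Fin N) (n+1) → A) : D x (ext (n+1) f) = ext n (d x n f) := by
  funext s
  by_cases h : s.card = n
  · simp only [D, ext, h, d, Multiset.card_cons]
    rfl
  · simp [D, ext, h]

lemma ext_zero (n : ℕ) : ext n (0 : Sym (Fin N) n → A) = 0 := by
  funext s; unfold ext; split_ifs <;> rfl

lemma ext_inj (n : ℕ) (f g : Sym (Fin N) n → A) (h : ext n f = ext n g) : f = g := by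
  funext s; rw [← ext_coe n f, h, ext_coe]

lemma d_d (hx : ∀ i, x i * x i = 0) (hxx : ∀ i j, x i * x j + x j * x i = 0) (n : ℕ)
    (f : Sym (Fin N) (n+2) → A) : d x n (d x (n+1) f) = 0 := by
  apply ext_inj
  rw [← D_ext, ← D_ext, D_D x hx hxx, ext_zero]

lemma exact_d (hx : ∀ i, x i * x i = 0) (hxx : ∀ i j, x i * x j + x j * x i = 0)
    (c : Fin N → A →+ A)
    (hc : ∀ i j b, c j (b * x i) = (if i = j then b else 0) - c j b * x i) (n : ℕ)
    (f : Sym (Fin N) (n+1) → A) (hf : d x n f = 0) : ∃ g, d x (n+1) g = f := by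
  obtain ⟨G, hG⟩ := exact_total x hx hxx c hc (ext (n+1) f)
    (by rw [D_ext, hf, ext_zero]) (by simp [ext])
  refine ⟨fun s => G s.1, funext fun s => ?_⟩
  rw [← ext_coe (n+1) f, ← hG]
  rfl

end Abstract

section Ext
variable (p : ℕ) [Fact p.Prime] (N : ℕ)

abbrev L := ExteriorAlgebra (ZMod p) (Fin N → ZMod p)

noncomputable def X (i : Fin N) : L p N := ExteriorAlgebra.ι (ZMod p) (Pi.single i 1)

noncomputable def ε : L p N →ₐ[ZMod p] ZMod p := ExteriorAlgebra.algebraMapInv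

lemma X_sq (i : Fin N) : X p N i * X p N i = 0 := ExteriorAlgebra.ι_sq_zero _

lemma X_anti (i j : Fin N) : X p N i * X p N j + X p N j * X p N i = 0 :=
  ExteriorAlgebra.ι_add_mul_swap _ _

lemma ε_X (i : Fin N) : ε p N (X p N i) = 0 := by
  simp [ε, X, ExteriorAlgebra.algebraMapInv]

noncomputable def c (j : Fin N) : L p N →+ L p N :=
  ((CliffordAlgebra.contractRight (Q := (0 : QuadraticForm (ZMod p) (Fin N → ZMod p)))).flip
    (LinearMap.proj j)).toAddMonoidHom

lemma c_mul (i j : Fin N) (b : L p N) :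
    c p N j (b * X p N i) = (if i = j then b else 0) - c p N j b * X p N i := by
  have := CliffordAlgebra.contractRight_mul_ι
    (Q := (0 : QuadraticForm (ZMod p) (Fin N → ZMod p))) (LinearMap.proj j) (Pi.single i 1) b
  refine Eq.trans this ?_
  congr 1
  by_cases h : i = j
  · subst h; simp
  · simp [h, Ne.symm h]

lemma decomp (a : L p N) : ∃ b : Fin N → L p N,
    a = algebraMap (ZMod p) _ (ε p N a) + ∑ i, b i * X p N i := by
  induction a using CliffordAlgebra.right_induction with
  | algebraMap r => 
    refine ⟨0, ?_⟩
    have : ε p N (algebraMap (ZMod p) (L p N) r) = r := by simp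
    erw [this]
    simp
  | add a b ha hb =>
    obtain ⟨u, hu⟩ := ha
    obtain ⟨v, hv⟩ := hb
    refine ⟨u + v, ?_⟩
    simp only [Pi.add_apply, add_mul, Finset.sum_add_distrib]
    conv_lhs => rw [hu, hv]
    erw [map_add (ε p N) a b]
    rw [map_add]
    abel
  | mul_ι m a _ =>
    refine ⟨fun i => m i • a, ?_⟩
    have h : ε p N (a * ExteriorAlgebra.ι (ZMod p) m) = 0 := by
      rw [map_mul]; simp [ε, ExteriorAlgebra.algebraMapInv]
    erw [h]
    have hm : m = ∑ i, m i • (Pi.single i 1 : Fin N → ZMod p) := by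
      funext k; simp [Finset.sum_apply, Pi.single_apply]
    have : ExteriorAlgebra.ι (ZMod p) m = ∑ i, m i • X p N i := by
      conv_lhs => rw [hm]
      simp [X]
    change a * ExteriorAlgebra.ι (ZMod p) m = _
    rw [this]
    simp [Finset.mul_sum]


/-- the trivial module -/
noncomputable abbrev kMod : Module (L p N) (ZMod p) :=
  ((ExteriorAlgebra.algebraMapInv :
          ExteriorAlgebra (ZMod p) (Fin N → ZMod p) →ₐ[ZMod p] ZMod p) :
        ExteriorAlgebra (ZMod p) (Fin N → ZMod p) →+* ZMod p).toModule

noncomputable def K : ModuleCat (L p N) :=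
  letI := kMod p N
  ModuleCat.of (L p N) (ZMod p)

lemma K_smul (a : L p N) (y : K p N) (ha : ε p N a = 0) : a • y = 0 := by
  have h : ∀ z : ZMod p, ε p N a * z = 0 := fun z => by rw [ha, zero_mul]
  exact h y

noncomputable abbrev P (n : ℕ) : ModuleCat (L p N) := ModuleCat.of (L p N) (Sym (Fin N) n → L p N)

noncomputable def cpx : ChainComplex (ModuleCat (L p N)) ℕ :=
  ChainComplex.of (P p N) (fun n => ModuleCat.ofHom (d (X p N) n)) (by
    intro n
    refine ModuleCat.hom_ext (LinearMap.ext fun f => ?_)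
    exact d_d (X p N) (X_sq p N) (X_anti p N) n f)

lemma cpx_d (n : ℕ) : (cpx p N).d (n+1) n = ModuleCat.ofHom (d (X p N) n) :=
  ChainComplex.of_d (P p N) (fun n => ModuleCat.ofHom (d (X p N) n)) n

noncomputable def augLin : letI := kMod p N; (Sym (Fin N) 0 → L p N) →ₗ[L p N] ZMod p :=
  letI := kMod p N
  { toFun := fun f => ε p N (f default)
    map_add' := fun f g => by simp
    map_smul' := fun a f => by
      change ε p N (a * f default) = ε p N a * ε p N (f default)
      rw [map_mul] }

noncomputable def aug : P p N 0 ⟶ K p N := letI := kMod p N; ModuleCat.ofHom (augLin p N)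

lemma aug_apply (f : Sym (Fin N) 0 → L p N) : (aug p N).hom f = ε p N (f default) := rfl

lemma ε_d (n : ℕ) (f : Sym (Fin N) (n+1) → L p N) (s) : ε p N (d (X p N) n f s) = 0 := by
  simp [d, ε_X]

lemma d_aug : (cpx p N).d 1 0 ≫ aug p N = 0 := by
  rw [cpx_d]
  refine ModuleCat.hom_ext (LinearMap.ext fun f => ?_)
  exact ε_d p N 0 f default

lemma aug_exact (f : Sym (Fin N) 0 → L p N) (hf : ε p N (f default) = 0) :
    ∃ g, d (X p N) 0 g = f := by
  obtain ⟨b, hb⟩ := decomp p N (f default)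
  rw [hf, map_zero, zero_add] at hb
  refine ⟨fun s => ∑ i, if s = i ::ₛ default then b i else 0, ?_⟩
  funext s
  obtain rfl : s = default := Subsingleton.elim _ _
  rw [hb]
  simp [d, Sym.cons_inj_left]

lemma exactAt (n : ℕ) : (cpx p N).ExactAt (n+1) := by
  rw [HomologicalComplex.exactAt_iff' _ (n + 1 + 1) (n + 1) n (by simp) (by simp)]
  rw [ShortComplex.moduleCat_exact_iff]
  intro f hf
  change ((cpx p N).d (n+1) n).hom f = 0 at hf
  rw [cpx_d] at hf
  obtain ⟨g, hg⟩ := exact_d (X p N) (X_sq p N) (X_anti p N) (c p N) (c_mul p N) n f hf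
  refine ⟨g, ?_⟩
  change ((cpx p N).d (n+1+1) (n+1)).hom g = f
  rw [cpx_d]
  exact hg

noncomputable def π : cpx p N ⟶ (ChainComplex.single₀ _).obj (K p N) :=
  (ChainComplex.toSingle₀Equiv _ _).symm ⟨aug p N, d_aug p N⟩

lemma aug_sc : (ShortComplex.mk _ _ (d_aug p N)).Exact := by
  rw [ShortComplex.moduleCat_exact_iff]
  intro f hf
  obtain ⟨g, hg⟩ := aug_exact p N f hf
  refine ⟨g, ?_⟩
  change ((cpx p N).d 1 0).hom g = f
  rw [cpx_d]
  exact hg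

lemma aug_epi : Epi (aug p N) := by
  rw [ModuleCat.epi_iff_surjective]
  intro y
  refine ⟨fun _ => algebraMap (ZMod p) _ (y : ZMod p), ?_⟩
  have h : ∀ z : ZMod p, ε p N (algebraMap (ZMod p) _ z) = z := fun z => by simp
  exact h y

lemma qi : QuasiIso (π p N) := ⟨fun n => by
    cases n
    · rw [ChainComplex.quasiIsoAt₀_iff, ShortComplex.quasiIso_iff_of_zeros']
      · refine (ShortComplex.exact_and_epi_g_iff_of_iso ?_).2
          ⟨aug_sc p N, aug_epi p N⟩
        exact ShortComplex.isoMk (Iso.refl _) (Iso.refl _) (Iso.refl _)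
          ((Category.id_comp _).trans (Category.comp_id _).symm) (by
            refine (Category.id_comp _).trans (Eq.trans ?_ (Category.comp_id _).symm)
            exact (ChainComplex.toSingle₀Equiv_symm_apply_f_zero (C := cpx p N) (aug p N) (d_aug p N)).symm)
      all_goals rfl
    · rw [quasiIsoAt_iff_exactAt']
      · apply exactAt
      · apply ChainComplex.exactAt_succ_single_obj⟩

noncomputable def res : ProjectiveResolution (K p N) where
  complex := cpx p N
  projective n := by
    change Projective (P p N n)
    infer_instance
  π := π p N
  quasiIso := qi p N

lemma hom_d (n : ℕ) (φ : P p N n ⟶ K p N) : ModuleCat.ofHom (d (X p N) n) ≫ φ = 0 := by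
  refine ModuleCat.hom_ext (LinearMap.ext fun f => ?_)
  change φ.hom (d (X p N) n f) = (0 : K p N)
  generalize hg : d (X p N) n f = g
  have hg' : ∀ s, ε p N (g s) = 0 := fun s => by rw [← hg]; exact ε_d p N n f s
  have : g = ∑ s, g s • (Pi.single s 1 : Sym (Fin N) n → L p N) := by
    funext k; simp [Finset.sum_apply, Pi.single_apply]
  rw [this, map_sum]
  refine Finset.sum_eq_zero fun s _ => ?_
  rw [map_smul, K_smul p N _ _ (hg' s)]

lemma lin_d (i j : ℕ) : ((cpx p N).linearYonedaObj ℤ (K p N)).d i j = 0 := by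
  refine ModuleCat.hom_ext (LinearMap.ext fun φ => ?_)
  change (cpx p N).d j i ≫ φ = 0
  by_cases h : j = i + 1
  · subst h
    rw [cpx_d]
    exact hom_d p N i φ
  · rw [(cpx p N).shape _ _ (by simpa using fun h' => h h'.symm)]
    exact Limits.zero_comp

noncomputable def homIso (m : ℕ) : ((cpx p N).linearYonedaObj ℤ (K p N)).homology m ≅
    ((cpx p N).linearYonedaObj ℤ (K p N)).X m :=
  (ShortComplex.HomologyData.ofZeros (((cpx p N).linearYonedaObj ℤ (K p N)).sc m)
    (lin_d p N _ _) (lin_d p N _ _)).left.homologyIso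

lemma card_hom (m : ℕ) : Nat.card (P p N m ⟶ K p N) = p ^ Fintype.card (Sym (Fin N) m) := by
  let := kMod p N
  rw [Nat.card_congr (ModuleCat.homEquiv.trans
    ((Pi.basisFun (L p N) (Sym (Fin N) m)).constr (M' := ZMod p) ℕ).symm.toEquiv)]
  rw [Nat.card_fun, Nat.card_zmod, Nat.card_eq_fintype_card]

end Ext
end Koszul

/-- For `Λ` the exterior algebra over `𝔽_p` on an `N`-dimensional vector space and
`k = 𝔽_p` a left `Λ`-module via the augmentation, `Ext^m_Λ(k, k)` has cardinality
`p ^ (binom (m + N - 1) (N - 1))`, i.e. `Ext^*_Λ(k, k)` has the size of a polynomial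
algebra over `𝔽_p` on `N` generators. -/
theorem stmt_5 (p : ℕ) [Fact p.Prime] (N : ℕ) (hN : 1 ≤ N) (m : ℕ) :
    letI : Module (ExteriorAlgebra (ZMod p) (Fin N → ZMod p)) (ZMod p) :=
      ((ExteriorAlgebra.algebraMapInv :
          ExteriorAlgebra (ZMod p) (Fin N → ZMod p) →ₐ[ZMod p] ZMod p) :
        ExteriorAlgebra (ZMod p) (Fin N → ZMod p) →+* ZMod p).toModule
    Nat.card
        (((Ext ℤ (ModuleCat (ExteriorAlgebra (ZMod p) (Fin N → ZMod p))) m).obj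
          (Opposite.op (ModuleCat.of _ (ZMod p)))).obj (ModuleCat.of _ (ZMod p))) =
      p ^ (m + N - 1).choose (N - 1) := by
  have e := (Koszul.res p N).isoExt (R := ℤ) m (Koszul.K p N) ≪≫ Koszul.homIso p N m
  refine (Nat.card_congr e.toLinearEquiv.toEquiv).trans ?_
  refine (Koszul.card_hom p N m).trans ?_
  rw [Sym.card_sym_eq_choose, Fintype.card_fin, Nat.add_comm N m]
  congr 1
  rw [← Nat.choose_symm_of_eq_add]
  omega
end

section
/- Let p be a prime, let R = MvPolynomial ℕ ℤ be the polynomial ring over ℤ on countably infinitely many variables x_1, x_2, … (modelling MU_* = ℤ[x_1, x_2, …]), and let k = ZMod p be regarded as an R-module via the ring homomorphism R → ZMod p sending every variable to 0 and reducing constants modulo p. Then Tor_0^R(k, k) has cardinality p, and for every j ≥ 1 the abelian group Tor_j^R(k, k) is countably infinite. (This is the additive content of the paper's Proposition that H_*^{MU}(H𝔽_p; 𝔽_p) ≅ Λ_{𝔽_p}(α̃_0, α̃_1, α̃_2, …) is an exterior algebra on countably many generators, so that each positive Tor-degree is an 𝔽_p-vector space of countably infinite dimension.) -/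
open CategoryTheory

namespace KoszulAux
noncomputable section

variable {R : Type} [CommRing R]

abbrev K (R : Type) [CommRing R] := Finset ℕ →₀ R

def sgn (R : Type) [CommRing R] (i : ℕ) (S : Finset ℕ) : R := (-1) ^ (S.filter (· < i)).card

lemma sgn_mul_self (i : ℕ) (S : Finset ℕ) : sgn R i S * sgn R i S = 1 := by
  unfold sgn; rw [← mul_pow]; simp

lemma sgn_insert (i j : ℕ) (S : Finset ℕ) (h : j ∉ S) :
    sgn R i (insert j S) = (if j < i then -1 else 1) * sgn R i S := by
  unfold sgn
  rw [Finset.filter_insert]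
  split_ifs
  · rw [Finset.card_insert_of_notMem (by simp [h]), pow_succ']
  · simp

lemma sgn_insert_self (i : ℕ) (S : Finset ℕ) : sgn R i (insert i S) = sgn R i S := by
  unfold sgn
  rw [Finset.filter_insert]; simp

/-- contraction -/
def del (R : Type) [CommRing R] (i : ℕ) : K R →ₗ[R] K R :=
  Finsupp.linearCombination R
    (fun S => if i ∈ S then Finsupp.single (S.erase i) (sgn R i S) else 0)

/-- wedge -/
def eps (R : Type) [CommRing R] (i : ℕ) : K R →ₗ[R] K R :=
  Finsupp.linearCombination R
    (fun S => if i ∈ S then 0 else Finsupp.single (insert i S) (sgn R i S))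

lemma del_notMem {i : ℕ} {S : Finset ℕ} (h : i ∉ S) (c : R) :
    del R i (Finsupp.single S c) = 0 := by
  simp [del, h]

lemma del_insert {i : ℕ} {S : Finset ℕ} (h : i ∉ S) (c : R) :
    del R i (Finsupp.single (insert i S) c) = Finsupp.single S (sgn R i S * c) := by
  simp [del, h, sgn_insert_self, mul_comm]

lemma eps_mem {i : ℕ} {S : Finset ℕ} (h : i ∈ S) (c : R) :
    eps R i (Finsupp.single S c) = 0 := by
  simp [eps, h]

lemma eps_notMem {i : ℕ} {S : Finset ℕ} (h : i ∉ S) (c : R) :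
    eps R i (Finsupp.single S c) = Finsupp.single (insert i S) (sgn R i S * c) := by
  simp [eps, h, mul_comm]

lemma exists_insert {i : ℕ} {S : Finset ℕ} (h : i ∈ S) : ∃ T, i ∉ T ∧ S = insert i T :=
  ⟨S.erase i, by simp, by simp [h]⟩

lemma del_del_self (i : ℕ) (z : K R) : del R i (del R i z) = 0 := by
  induction z using Finsupp.induction_linear with
  | zero => simp
  | add f g hf hg => simp [hf, hg]
  | single S c =>
    by_cases h : i ∈ S
    · obtain ⟨T, hT, rfl⟩ := exists_insert h
      rw [del_insert hT, del_notMem hT]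
    · simp [del_notMem h]

lemma del_del (i j : ℕ) (z : K R) : del R i (del R j z) = - del R j (del R i z) := by
  rcases eq_or_ne i j with rfl | hij
  · simp [del_del_self]
  induction z using Finsupp.induction_linear with
  | zero => simp
  | add f g hf hg => simp [hf, hg, add_comm]
  | single S c =>
    by_cases h : i ∈ S
    · obtain ⟨T, hT, rfl⟩ := exists_insert h
      by_cases h' : j ∈ T
      · obtain ⟨U, hU, rfl⟩ := exists_insert h'
        have hiU : i ∉ U := fun h => hT (by simp [h])
        have hjU : j ∉ insert i U := by simp [hU, hij.symm]
        rw [del_insert hT, del_insert hU, Finset.insert_comm, del_insert hjU, del_insert hiU,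
          ← Finsupp.single_neg]
        congr 1
        rw [sgn_insert _ _ _ hiU, sgn_insert _ _ _ hU]
        rcases lt_or_gt_of_ne hij with h1 | h1 <;> simp [h1, h1.not_gt] <;> ring
      · rw [del_insert hT, del_notMem h', del_notMem (by simp [h', hij.symm])]; simp
    · rw [del_notMem h]
      by_cases h' : j ∈ S
      · obtain ⟨U, hU, rfl⟩ := exists_insert h'
        rw [del_insert hU, del_notMem (by simp at h; tauto)]; simp
      · simp [del_notMem h']

lemma del_eps_self (i : ℕ) (z : K R) : del R i (eps R i z) = z - eps R i (del R i z) := by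
  induction z using Finsupp.induction_linear with
  | zero => simp
  | add f g hf hg => simp [hf, hg]; abel
  | single S c =>
    by_cases h : i ∈ S
    · obtain ⟨T, hT, rfl⟩ := exists_insert h
      rw [del_insert hT, eps_mem h, eps_notMem hT, ← mul_assoc, sgn_mul_self]; simp
    · rw [del_notMem h, eps_notMem h, del_insert h, ← mul_assoc, sgn_mul_self]; simp

lemma del_eps (i j : ℕ) (hij : i ≠ j) (z : K R) : del R i (eps R j z) = - eps R j (del R i z) := by
  induction z using Finsupp.induction_linear with
  | zero => simp
  | add f g hf hg => simp [hf, hg, add_comm]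
  | single S c =>
    by_cases h : i ∈ S
    · obtain ⟨T, hT, rfl⟩ := exists_insert h
      by_cases h' : j ∈ T
      · rw [del_insert hT, eps_mem (by simp [h']), eps_mem h']; simp
      · have h2 : i ∉ insert j T := by simp [hT, hij]
        rw [del_insert hT, eps_notMem (by simp [h', hij.symm]), eps_notMem h',
          Finset.insert_comm, del_insert h2, ← Finsupp.single_neg]
        congr 1
        rw [sgn_insert _ _ _ hT, sgn_insert _ _ _ h']
        rcases lt_or_gt_of_ne hij with h1 | h1 <;> simp [h1, h1.not_gt] <;> ring
    · rw [del_notMem h]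
      by_cases h' : j ∈ S
      · simp [eps_mem h']
      · rw [eps_notMem h', del_notMem (by simp [h, hij])]; simp

variable (a : ℕ → R)

/-- Koszul differential -/
def D : K R →ₗ[R] K R :=
  Finsupp.linearCombination R (fun S => ∑ i ∈ S, a i • del R i (Finsupp.single S 1))

lemma D_single (S T : Finset ℕ) (h : S ⊆ T) (c : R) :
    D a (Finsupp.single S c) = ∑ i ∈ T, a i • del R i (Finsupp.single S c) := by
  rw [← Finset.sum_subset h]
  · simp only [D, Finsupp.linearCombination_single, Finset.smul_sum]
    refine Finset.sum_congr rfl fun i _ => ?_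
    rw [smul_comm, ← map_smul]; simp
  · intro i _ hi; simp [del_notMem hi]

/-- the span of `e_S` with `S ⊆ T` -/
def Sub (R : Type) [CommRing R] (s : Set (Finset ℕ)) : Submodule R (K R) := Finsupp.supported R R s

lemma single_mem {s : Set (Finset ℕ)} {S : Finset ℕ} (h : S ∈ s) (c : R) :
    Finsupp.single S c ∈ Sub R s := Finsupp.single_mem_supported _ _ h

lemma map_mem {s : Set (Finset ℕ)} (T : K R →ₗ[R] K R) (N : Submodule R (K R))
    (h : ∀ S ∈ s, T (Finsupp.single S 1) ∈ N) {z : K R} (hz : z ∈ Sub R s) : T z ∈ N := by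
  have : Sub R s ≤ N.comap T := by
    unfold Sub
    rw [Finsupp.supported_eq_span_single, Submodule.span_le]
    rintro _ ⟨S, hS, rfl⟩
    exact h S hS
  exact this hz

lemma D_eq (T : Finset ℕ) {z : K R} (hz : z ∈ Sub R {S | S ⊆ T}) :
    D a z = ∑ i ∈ T, a i • del R i z := by
  have := map_mem (D a - ∑ i ∈ T, a i • del R i) ⊥ (s := {S | S ⊆ T}) ?_ hz
  · simpa [sub_eq_zero] using this
  · intro S hS
    simp [D_single a S T hS]

lemma del_mem_sub (i : ℕ) (T : Finset ℕ) {z : K R} (hz : z ∈ Sub R {S | S ⊆ T}) :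
    del R i z ∈ Sub R {S | S ⊆ T} := by
  refine map_mem _ _ ?_ hz
  intro S hS
  by_cases h : i ∈ S
  · obtain ⟨U, hU, rfl⟩ := exists_insert h
    rw [del_insert hU]
    exact single_mem (by exact (Finset.subset_insert _ _).trans hS) _
  · simp [del_notMem h]

lemma del_D (n : ℕ) (z : K R) : del R n (D a z) = - D a (del R n z) := by
  induction z using Finsupp.induction_linear with
  | zero => simp
  | add f g hf hg => simp [hf, hg, add_comm]
  | single S c =>
    have h : Finsupp.single S c ∈ Sub R {U | U ⊆ S} := single_mem (by simp) c
    rw [D_eq a S h, D_eq a S (del_mem_sub n S h)]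
    simp [del_del n]

lemma D_D [IsDomain R] [CharZero R] (z : K R) : D a (D a z) = 0 := by
  induction z using Finsupp.induction_linear with
  | zero => simp
  | add f g hf hg => simp [hf, hg]
  | single S c =>
    have h : Finsupp.single S c ∈ Sub R {U | U ⊆ S} := single_mem (by simp) c
    have h2 : D a (Finsupp.single S c) ∈ Sub R {U | U ⊆ S} := by
      rw [D_eq a S h]
      exact Submodule.sum_mem _ fun i _ => Submodule.smul_mem _ _ (del_mem_sub i S h)
    have h3 : D a (D a (Finsupp.single S c)) = - D a (D a (Finsupp.single S c)) := by
      conv_lhs => rw [D_eq a S h2]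
      conv_rhs => enter [1, 2]; rw [D_eq a S h]
      simp [del_D]
    ext U
    have := DFunLike.congr_fun h3 U
    simp only [Finsupp.neg_apply, Finsupp.zero_apply] at this ⊢
    exact self_eq_neg.mp this

lemma D_eps (n : ℕ) (z : K R) : D a (eps R n z) = a n • z - eps R n (D a z) := by
  induction z using Finsupp.induction_linear with
  | zero => simp
  | add f g hf hg => simp [hf, hg]; abel
  | single S c =>
    have h : Finsupp.single S c ∈ Sub R {U | U ⊆ insert n S} := single_mem (by simp) c
    have h2 : eps R n (Finsupp.single S c) ∈ Sub R {U | U ⊆ insert n S} := by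
      by_cases hn : n ∈ S
      · simp [eps_mem hn]
      · rw [eps_notMem hn]; exact single_mem (by simp) _
    rw [D_eq a _ h, D_eq a _ h2, map_sum, ← Finset.add_sum_erase _ _ (Finset.mem_insert_self n S),
      ← Finset.add_sum_erase _ (fun i => eps R n (a i • _)) (Finset.mem_insert_self n S),
      del_eps_self, smul_sub, map_smul, sub_add_eq_sub_sub, sub_eq_add_neg (a n • _ - _),
      ← Finset.sum_neg_distrib]
    congr 1
    refine Finset.sum_congr rfl fun i hi => ?_
    rw [del_eps _ _ (Finset.ne_of_mem_erase hi)]; simp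

/-- the bounded part -/
def Kn (R : Type) [CommRing R] (n j : ℕ) : Submodule R (K R) :=
  Sub R {S | S.card = j ∧ ∀ i ∈ S, i < n}

lemma single_mem_Kn {n j : ℕ} {S : Finset ℕ} (h1 : S.card = j) (h2 : ∀ i ∈ S, i < n) (c : R) :
    Finsupp.single S c ∈ Kn R n j :=
  Finsupp.single_mem_supported _ _ (show S ∈ {S : Finset ℕ | S.card = j ∧ ∀ i ∈ S, i < n} from ⟨h1, h2⟩)

lemma del_Kn (n j : ℕ) {z : K R} (hz : z ∈ Kn R (n+1) (j+1)) : del R n z ∈ Kn R n j := by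
  refine map_mem _ _ ?_ hz
  rintro S ⟨h1, h2⟩
  by_cases h : n ∈ S
  · obtain ⟨U, hU, rfl⟩ := exists_insert h
    rw [del_insert hU]
    refine single_mem_Kn (by simpa [hU] using h1) (fun i hi => ?_) _
    have := h2 i (by simp [hi])
    have : i ≠ n := by rintro rfl; exact hU hi
    omega
  · simp [del_notMem h]

lemma eps_Kn (n j : ℕ) {z : K R} (hz : z ∈ Kn R n j) : eps R n z ∈ Kn R (n+1) (j+1) := by
  refine map_mem _ _ ?_ hz
  rintro S ⟨h1, h2⟩
  have h : n ∉ S := fun h => (h2 n h).false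
  rw [eps_notMem h]
  refine single_mem_Kn (by simpa [h] using h1) (fun i hi => ?_) _
  rcases Finset.mem_insert.mp hi with rfl | hi
  · omega
  · have := h2 i hi; omega

lemma Kn_mono (n j : ℕ) : Kn R n j ≤ Kn R (n+1) j :=
  Finsupp.supported_mono fun _ hS => ⟨hS.1, fun i hi => (hS.2 i hi).trans (by omega)⟩

lemma sub_Kn (n j : ℕ) {z : K R} (hz : z ∈ Kn R (n+1) j) :
    z - eps R n (del R n z) ∈ Kn R n j := by
  refine map_mem (LinearMap.id - eps R n ∘ₗ del R n) _ ?_ hz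
  rintro S ⟨h1, h2⟩
  by_cases h : n ∈ S
  · obtain ⟨U, hU, rfl⟩ := exists_insert h
    simp [del_insert hU, eps_notMem hU, sgn_mul_self]
  · simp only [LinearMap.sub_apply, LinearMap.id_apply, LinearMap.comp_apply, del_notMem h, map_zero, sub_zero]
    refine single_mem_Kn h1 (fun i hi => ?_) _
    have := h2 i hi
    have : i ≠ n := by rintro rfl; exact h hi
    omega

def J (n : ℕ) : Ideal R := Ideal.span (a '' Set.Iio n)

lemma D_Kn_one (n : ℕ) {z : K R} (hz : z ∈ Kn R n 1) :
    ∃ g ∈ J a n, D a z = Finsupp.single ∅ g := by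
  have : D a z ∈ Submodule.map (Finsupp.lsingle ∅ : R →ₗ[R] K R) (J a n) := by
    refine map_mem _ _ ?_ hz
    rintro S ⟨h1, h2⟩
    obtain ⟨i, rfl⟩ := Finset.card_eq_one.mp h1
    refine ⟨a i, Ideal.subset_span ⟨i, h2 i (by simp), rfl⟩, ?_⟩
    rw [D_single a _ _ subset_rfl]
    have := del_insert (R := R) (i := i) (S := ∅) (by simp) 1
    simp only [insert_empty_eq] at this
    simp [this, sgn]
  obtain ⟨g, hg, h⟩ := this
  exact ⟨g, hg, h.symm⟩

lemma J_lift (n : ℕ) {g : R} (hg : g ∈ J a n) :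
    ∃ z ∈ Kn R n 1, D a z = Finsupp.single ∅ g := by
  have : J a n ≤ ((Kn R n 1).map (D a)).comap (Finsupp.lsingle ∅ : R →ₗ[R] K R) := by
    unfold J Ideal.span
    rw [Submodule.span_le]
    rintro _ ⟨i, hi, rfl⟩
    refine ⟨Finsupp.single {i} 1, single_mem_Kn (by simp) (by simpa using hi) _, ?_⟩
    rw [D_single a _ _ subset_rfl]
    have := del_insert (R := R) (i := i) (S := ∅) (by simp) 1
    simp only [insert_empty_eq] at this
    simp [this, sgn]
  exact this hg

lemma Kn_zero (n : ℕ) {z : K R} (hz : z ∈ Kn R n 0) : z = Finsupp.single ∅ (z ∅) := by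
  ext S
  by_cases h : S = ∅
  · simp [h]
  · rw [Finsupp.single_apply, if_neg (Ne.symm h)]
    by_contra h'
    have := (Finsupp.mem_supported _ _).mp hz (Finsupp.mem_support_iff.mpr h')
    exact h (Finset.card_eq_zero.mp this.1)

theorem exact_Kn [IsDomain R] [CharZero R] (hreg : ∀ n f, a n * f ∈ J a n → f ∈ J a n) (n : ℕ) :
    ∀ (j : ℕ) (z : K R), z ∈ Kn R n (j+1) → D a z = 0 → ∃ w ∈ Kn R n (j+2), D a w = z := by
  induction n with
  | zero =>
    intro j z hz _
    refine ⟨0, Submodule.zero_mem _, ?_⟩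
    have : {S : Finset ℕ | S.card = j+1 ∧ ∀ i ∈ S, i < 0} = ∅ := by
      ext S
      simp only [Set.mem_ofPred_eq, Set.mem_empty_iff_false, iff_false]
      rintro ⟨h1, h2⟩
      obtain ⟨i, hi⟩ := Finset.card_pos.mp (by omega : 0 < S.card)
      exact absurd (h2 i hi) (by omega)
    unfold Kn Sub at hz
    rw [this, Finsupp.supported_empty] at hz
    simpa using ((Submodule.mem_bot R).mp hz).symm
  | succ n ih =>
    intro j z hz hDz
    have hv := del_Kn n j hz
    have hu := sub_Kn n _ hz
    have hDv : D a (del R n z) = 0 := by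
      have := del_D a n z
      rw [hDz] at this; simpa using this.symm
    obtain ⟨w, hw, hDw⟩ : ∃ w ∈ Kn R n (j+1), D a w = del R n z := by
      rcases j with _ | j
      · obtain ⟨g, hg, hDu⟩ := D_Kn_one a n hu
        rw [map_sub, hDz, D_eps, hDv, Kn_zero n hv] at hDu
        have h1 := DFunLike.congr_fun hDu ∅
        simp only [map_zero, sub_zero, zero_sub, Finsupp.neg_apply, Finsupp.smul_apply, smul_eq_mul,
          Finsupp.single_eq_same] at h1
        rw [Kn_zero n hv]
        apply J_lift
        apply hreg
        rw [← neg_mem_iff, h1]; exact hg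
      · exact ih j _ hv hDv
    obtain ⟨w', hw', hDw'⟩ := ih j (z - eps R n (del R n z) + a n • w)
      (Submodule.add_mem _ hu (Submodule.smul_mem _ _ hw)) (by
        rw [map_add, map_sub, hDz, D_eps, hDv, map_smul, hDw]; simp)
    refine ⟨w' - eps R n w, Submodule.sub_mem _ (Kn_mono _ _ hw') (eps_Kn _ _ hw), ?_⟩
    rw [map_sub, hDw', D_eps, hDw]; abel

/-- graded pieces -/
def P (R : Type) [CommRing R] (j : ℕ) : Submodule R (K R) := Sub R {S | S.card = j}

lemma Kn_le_P (n j : ℕ) : Kn R n j ≤ P R j := Finsupp.supported_mono fun _ hS => hS.1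

lemma exists_Kn (j : ℕ) {z : K R} (hz : z ∈ P R j) : ∃ n, z ∈ Kn R n j := by
  refine ⟨(z.support.sup id).sup id + 1, (Finsupp.mem_supported _ _).mpr ?_⟩
  intro S hS
  refine ⟨(Finsupp.mem_supported _ _).mp hz hS, fun i hi => Nat.lt_succ_of_le ?_⟩
  have h1 : i ∈ z.support.sup id := Finset.mem_sup.mpr ⟨S, hS, hi⟩
  exact Finset.le_sup (f := id) h1

lemma D_P (j : ℕ) {z : K R} (hz : z ∈ P R (j+1)) : D a z ∈ P R j := by
  refine map_mem _ _ ?_ hz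
  intro S hS
  rw [D_single a _ _ subset_rfl]
  refine Submodule.sum_mem _ fun i hi => Submodule.smul_mem _ _ ?_
  obtain ⟨U, hU, rfl⟩ := exists_insert hi
  rw [del_insert hU]
  exact single_mem (by simpa [hU] using hS) _

theorem exact_P [IsDomain R] [CharZero R] (hreg : ∀ n f, a n * f ∈ J a n → f ∈ J a n)
    (j : ℕ) (z : K R) (hz : z ∈ P R (j+1)) (h : D a z = 0) : ∃ w ∈ P R (j+2), D a w = z := by
  obtain ⟨n, hn⟩ := exists_Kn _ hz
  obtain ⟨w, hw, hD⟩ := exact_Kn a hreg n j z hn h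
  exact ⟨w, Kn_le_P _ _ hw, hD⟩

/-! ### The specific sequence -/

def seq (p : ℕ) : ℕ → MvPolynomial ℕ ℤ
  | 0 => (p : MvPolynomial ℕ ℤ)
  | i+1 => MvPolynomial.X i

lemma mem_J (p n : ℕ) (f : MvPolynomial ℕ ℤ) :
    f ∈ J (seq p) (n+1) ↔ ∀ m : ℕ →₀ ℕ, (∀ j < n, m j = 0) → (p : ℤ) ∣ f.coeff m := by
  constructor
  · intro hf
    unfold J Ideal.span at hf
    induction hf using Submodule.span_induction with
    | zero => simp
    | add f g _ _ hf hg => intro m hm; simpa using dvd_add (hf m hm) (hg m hm)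
    | mem x hx =>
      obtain ⟨i, hi, rfl⟩ := hx
      intro m hm
      rcases i with _ | i
      · rw [seq, ← map_natCast (MvPolynomial.C (σ := ℕ) (R := ℤ)), MvPolynomial.coeff_C]
        split_ifs <;> simp
      · rw [seq, MvPolynomial.coeff_X, if_neg]
        · simp
        · rintro rfl
          have := hm i (by simpa using hi)
          simp at this
    | smul r x _ hx =>
      intro m hm
      rw [smul_eq_mul, MvPolynomial.coeff_mul]
      refine Finset.dvd_sum fun y hy => Dvd.dvd.mul_left (hx _ fun j hj => ?_) _
      have := DFunLike.congr_fun (Finset.HasAntidiagonal.mem_antidiagonal.mp hy) j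
      have h2 := hm j hj
      simp only [Finsupp.add_apply] at this
      omega
  · intro h
    rw [f.as_sum]
    refine Ideal.sum_mem _ fun m _ => ?_
    by_cases hm : ∀ j < n, m j = 0
    · obtain ⟨c, hc⟩ := h m hm
      have : MvPolynomial.monomial m (f.coeff m) = MvPolynomial.monomial m c * seq p 0 := by
        rw [hc, seq, ← map_natCast (MvPolynomial.C (σ := ℕ) (R := ℤ)), mul_comm _ (MvPolynomial.C _), MvPolynomial.C_mul_monomial]
      rw [this]
      exact Ideal.mul_mem_left _ _ (Ideal.subset_span ⟨0, by simp, rfl⟩)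
    · push Not at hm
      obtain ⟨j, hj, hmj⟩ := hm
      have : seq p (j+1) ∣ MvPolynomial.monomial m (f.coeff m) := by
        rw [seq, MvPolynomial.X_dvd_monomial]; exact Or.inr hmj
      exact Ideal.mem_of_dvd _ this (Ideal.subset_span ⟨j+1, by simpa using hj, rfl⟩)

lemma seq_reg (p : ℕ) (hp : p.Prime) (n : ℕ) (f : MvPolynomial ℕ ℤ)
    (h : seq p n * f ∈ J (seq p) n) : f ∈ J (seq p) n := by
  rcases n with _ | n
  · have h0 : J (seq p) 0 = ⊥ := by simp [J]
    rw [h0, Ideal.mem_bot] at h ⊢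
    simpa [seq, hp.ne_zero] using h
  · rw [mem_J] at h ⊢
    intro m hm
    have := h (Finsupp.single n 1 + m) fun j hj => by
      simp [hm j hj, hj.ne']
    rwa [seq, MvPolynomial.coeff_X_mul] at this

abbrev aug (p : ℕ) : MvPolynomial ℕ ℤ →+* ZMod p :=
  MvPolynomial.eval₂Hom (Int.castRingHom (ZMod p)) (fun _ => 0)

lemma aug_eq (p : ℕ) (f : MvPolynomial ℕ ℤ) : aug p f = ((f.coeff 0 : ℤ) : ZMod p) := by
  simp [aug, MvPolynomial.constantCoeff_eq]

lemma ker_aug (p : ℕ) (f : MvPolynomial ℕ ℤ) : aug p f = 0 ↔ ∃ n, f ∈ J (seq p) n := by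
  rw [aug_eq, ZMod.intCast_zmod_eq_zero_iff_dvd]
  constructor
  · intro h
    refine ⟨f.vars.sup id + 1 + 1, (mem_J _ _ _).mpr fun m hm => ?_⟩
    by_cases h0 : f.coeff m = 0
    · simp [h0]
    · have : m = 0 := by
        ext j
        by_contra hj
        have h1 : j ∈ f.vars :=
          (MvPolynomial.mem_vars_iff_mem_support j).mpr ⟨m, by simpa using h0, by simpa using hj⟩
        exact hj (hm j (Nat.lt_succ_of_le (Finset.le_sup (f := id) h1)))
      rwa [this]
  · rintro ⟨n, hn⟩
    have : f ∈ J (seq p) (n+1) := Ideal.span_mono (Set.image_mono (Set.Iio_subset_Iio (by omega))) hn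
    exact (mem_J _ _ _).mp this 0 (by simp)

/-! ### Categorical part -/

section Cat

variable {A : Type} [AddCommGroup A] [Module R A]

/-- differential on graded pieces -/
def dP (j : ℕ) : P R (j+1) →ₗ[R] P R j := (D a).restrict fun _ hz => D_P a j hz

lemma dP_mem (j : ℕ) (z : P R (j+1)) : dP a j z ∈ (Ideal.span (Set.range a)) • (⊤ : Submodule R (P R j)) := by
  have : D a z ∈ Submodule.map (P R j).subtype ((Ideal.span (Set.range a)) • (⊤ : Submodule R (P R j))) := by
    refine map_mem _ _ ?_ z.2
    intro S hS
    rw [D_single a _ _ subset_rfl]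
    refine Submodule.sum_mem _ fun i hi => ?_
    have h : del R i (Finsupp.single S 1) ∈ P R j := by
      obtain ⟨U, hU, rfl⟩ := exists_insert hi
      rw [del_insert hU]
      exact single_mem (by simpa [hU] using hS) _
    exact ⟨a i • ⟨_, h⟩, Submodule.smul_mem_smul (Ideal.subset_span ⟨i, rfl⟩) trivial, rfl⟩
  obtain ⟨y, hy, h⟩ := this
  have : dP a j z = y := Subtype.ext h.symm
  rwa [this]

lemma lTensor_dP (hA : ∀ i (x : A), a i • x = 0) (j : ℕ) : (dP a j).lTensor A = 0 := by
  ext x z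
  simp only [TensorProduct.AlgebraTensorModule.curry_apply, LinearMap.restrictScalars_self,
    TensorProduct.curry_apply, LinearMap.lTensor_tmul, LinearMap.zero_apply]
  have hA' : ∀ r ∈ Ideal.span (Set.range a), ∀ x : A, r • x = 0 := by
    intro r hr x
    have : Ideal.span (Set.range a) ≤ LinearMap.ker (LinearMap.toSpanSingleton R A x) := by
      rw [Ideal.span_le]
      rintro _ ⟨i, rfl⟩
      simpa using hA i x
    simpa using this hr
  refine Submodule.smul_induction_on (dP_mem a j z) ?_ ?_
  · intro r hr y _
    rw [← TensorProduct.smul_tmul, hA' r hr, TensorProduct.zero_tmul]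
  · intro y y' h h'
    rw [TensorProduct.tmul_add, h, h', add_zero]

/-- augmentation -/
def piP (q : R →ₗ[R] A) : P R 0 →ₗ[R] A := q ∘ₗ Finsupp.lapply ∅ ∘ₗ (P R 0).subtype

lemma P_zero {z : K R} (hz : z ∈ P R 0) : z = Finsupp.single ∅ (z ∅) := by
  obtain ⟨n, hn⟩ := exists_Kn _ hz
  exact Kn_zero n hn

lemma pi_d (q : R →ₗ[R] A) (hq : ∀ f, q f = 0 ↔ ∃ n, f ∈ J a n) : piP q ∘ₗ dP a 0 = 0 := by
  ext z
  obtain ⟨n, hn⟩ := exists_Kn _ z.2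
  obtain ⟨g, hg, h⟩ := D_Kn_one a n hn
  change q (D a z ∅) = 0
  rw [h, Finsupp.single_eq_same]
  exact (hq _).mpr ⟨n, hg⟩

lemma pi_exact (q : R →ₗ[R] A) (hq : ∀ f, q f = 0 ↔ ∃ n, f ∈ J a n) (z : P R 0)
    (hz : piP q z = 0) : ∃ w, dP a 0 w = z := by
  obtain ⟨n, hn⟩ := (hq _).mp hz
  obtain ⟨w, hw, h⟩ := J_lift a n hn
  exact ⟨⟨w, Kn_le_P _ _ hw⟩, Subtype.ext (h.trans (P_zero z.2).symm)⟩

lemma pi_surj (q : R →ₗ[R] A) (hs : Function.Surjective q) : Function.Surjective (piP q) := by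
  intro x
  obtain ⟨r, rfl⟩ := hs x
  exact ⟨⟨Finsupp.single ∅ r, single_mem (by simp) _⟩, by simp [piP]⟩

variable [IsDomain R] [CharZero R]

/-- the Koszul complex -/
def cx : ChainComplex (ModuleCat.{0} R) ℕ :=
  ChainComplex.of (fun j => ModuleCat.of R (P R j)) (fun j => ModuleCat.ofHom (dP a j)) (by
    intro n
    refine ModuleCat.hom_ext (LinearMap.ext fun z => ?_)
    exact Subtype.ext (D_D a z.1))

lemma cx_d (j : ℕ) : (cx a).d (j+1) j = ModuleCat.ofHom (dP a j) := by
  exact ChainComplex.of_d (fun j => ModuleCat.of R (P R j)) (fun j => ModuleCat.ofHom (dP a j)) j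

instance (j : ℕ) : Module.Free R (P R j) :=
  Module.Free.of_equiv (Finsupp.supportedEquivFinsupp (M := R) (R := R) {S : Finset ℕ | S.card = j}).symm

/-- the augmentation as a morphism -/
def piC (q : R →ₗ[R] A) : (cx a).X 0 ⟶ ModuleCat.of R A :=
  (ModuleCat.ofHom (piP q) : ModuleCat.of R (P R 0) ⟶ ModuleCat.of R A)

lemma hpi (q : R →ₗ[R] A) (hq : ∀ f, q f = 0 ↔ ∃ n, f ∈ J a n) :
    (cx a).d 1 0 ≫ piC a q = 0 := by
  rw [cx_d]
  exact ModuleCat.hom_ext (pi_d a q hq)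

def res (q : R →ₗ[R] A) (hq : ∀ f, q f = 0 ↔ ∃ n, f ∈ J a n) (hs : Function.Surjective q)
    (hreg : ∀ n f, a n * f ∈ J a n → f ∈ J a n) : ProjectiveResolution (ModuleCat.of R A) where
  complex := cx a
  projective n := by
    change Projective (ModuleCat.of R (P R n))
    infer_instance
  π := (ChainComplex.toSingle₀Equiv _ _).symm ⟨piC a q, hpi a q hq⟩
  quasiIso := ⟨fun n => by
    cases n with
    | zero =>
      rw [ChainComplex.quasiIsoAt₀_iff, ShortComplex.quasiIso_iff_of_zeros']
      · constructor
        · rw [ShortComplex.moduleCat_exact_iff]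
          intro z hz
          obtain ⟨w, hw⟩ := pi_exact a q hq z (by
            have := ChainComplex.toSingle₀Equiv_symm_apply_f_zero
              (piC a q) (hpi a q hq)
            change (((ChainComplex.toSingle₀Equiv _ _).symm ⟨piC a q, hpi a q hq⟩).f 0).hom z = 0 at hz
            rw [this] at hz
            exact hz)
          refine ⟨w, ?_⟩
          change ((cx a).d 1 0).hom w = z
          rw [cx_d]
          exact hw
        · change Epi (((ChainComplex.toSingle₀Equiv _ _).symm ⟨piC a q, hpi a q hq⟩).f 0)
          rw [ChainComplex.toSingle₀Equiv_symm_apply_f_zero]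
          exact (ModuleCat.epi_iff_surjective _).mpr (pi_surj q hs)
      all_goals rfl
    | succ n =>
      rw [quasiIsoAt_iff_exactAt']
      · rw [HomologicalComplex.exactAt_iff' _ (n + 1 + 1) (n + 1) n (by simp) (by simp),
          ShortComplex.moduleCat_exact_iff]
        intro z hz
        change ((cx a).d (n+1) n).hom z = 0 at hz
        rw [cx_d] at hz
        obtain ⟨w, hw, h⟩ := exact_P a hreg n z.1 z.2 (congrArg Subtype.val hz)
        refine ⟨⟨w, hw⟩, ?_⟩
        change ((cx a).d (n+1+1) (n+1)).hom ⟨w, hw⟩ = z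
        rw [cx_d]
        exact Subtype.ext h
      · apply ChainComplex.exactAt_succ_single_obj⟩

theorem tor_equiv (q : R →ₗ[R] A) (hq : ∀ f, q f = 0 ↔ ∃ n, f ∈ J a n)
    (hs : Function.Surjective q) (hreg : ∀ n f, a n * f ∈ J a n → f ∈ J a n)
    (hA : ∀ i (x : A), a i • x = 0) (j : ℕ) :
    Nonempty ((((Tor (ModuleCat.{0} R) j).obj (ModuleCat.of R A)).obj (ModuleCat.of R A)) ≃
      ({S : Finset ℕ | S.card = j} →₀ A)) := by
  let F := (MonoidalCategory.tensoringLeft (ModuleCat.{0} R)).obj (ModuleCat.of R A)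
  let C := (F.mapHomologicalComplex (ComplexShape.down ℕ)).obj (cx a)
  have hd : ∀ i k, C.d i k = 0 := by
    intro i k
    by_cases h : k + 1 = i
    · subst h
      change F.map ((cx a).d (k+1) k) = 0
      rw [cx_d]
      exact ModuleCat.hom_ext (lTensor_dP a hA k)
    · exact C.shape _ _ h
  let e1 : ((Tor (ModuleCat.{0} R) j).obj (ModuleCat.of R A)).obj (ModuleCat.of R A) ≅
      C.homology j := (res a q hq hs hreg).isoLeftDerivedObj F j
  let e2 : C.homology j ≅ C.X j :=
    (ShortComplex.HomologyData.ofZeros (C.sc j) (hd _ _) (hd _ _)).left.homologyIso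
  let e3 : C.X j ≃ₗ[R] TensorProduct R A (P R j) := LinearEquiv.refl R _
  let e4 : TensorProduct R A (P R j) ≃ₗ[R] TensorProduct R A ({S : Finset ℕ | S.card = j} →₀ R) :=
    LinearEquiv.lTensor A
      (Finsupp.supportedEquivFinsupp (M := R) (R := R) {S : Finset ℕ | S.card = j})
  exact ⟨((e1 ≪≫ e2).toLinearEquiv ≪≫ₗ e3 ≪≫ₗ e4 ≪≫ₗ
    TensorProduct.finsuppScalarRight R R A {S : Finset ℕ | S.card = j}).toEquiv⟩

end Cat

end
end KoszulAux

/-- For `R = ℤ[x_1, x_2, …]` (modelling `MU_*`) and `k = 𝔽_p` an `R`-module via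
the augmentation, `Tor_0^R(k, k)` has cardinality `p`, and `Tor_j^R(k, k)` is
countably infinite for every `j ≥ 1`. -/
theorem stmt_6 (p : ℕ) (hp : p.Prime) :
    letI : Module (MvPolynomial ℕ ℤ) (ZMod p) :=
      (MvPolynomial.eval₂Hom (Int.castRingHom (ZMod p)) (fun _ => 0)).toModule
    Nat.card
        (((Tor (ModuleCat (MvPolynomial ℕ ℤ)) 0).obj
          (ModuleCat.of _ (ZMod p))).obj (ModuleCat.of _ (ZMod p))) = p ∧
    ∀ j : ℕ, 1 ≤ j →
      Countable
        (((Tor (ModuleCat (MvPolynomial ℕ ℤ)) j).obj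
          (ModuleCat.of _ (ZMod p))).obj (ModuleCat.of _ (ZMod p))) ∧
      Infinite
        (((Tor (ModuleCat (MvPolynomial ℕ ℤ)) j).obj
          (ModuleCat.of _ (ZMod p))).obj (ModuleCat.of _ (ZMod p))) := by
  let inst : Module (MvPolynomial ℕ ℤ) (ZMod p) :=
      (MvPolynomial.eval₂Hom (Int.castRingHom (ZMod p)) (fun _ => 0)).toModule
  have hsmul : ∀ (r : MvPolynomial ℕ ℤ) (x : ZMod p), r • x = KoszulAux.aug p r * x :=
    fun _ _ => rfl
  have : Fact p.Prime := ⟨hp⟩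
  let q : MvPolynomial ℕ ℤ →ₗ[MvPolynomial ℕ ℤ] ZMod p :=
    { toFun := KoszulAux.aug p
      map_add' := map_add _
      map_smul' := fun r x => by simp only [smul_eq_mul, map_mul, RingHom.id_apply, hsmul] }
  have key := KoszulAux.tor_equiv (KoszulAux.seq p) q (KoszulAux.ker_aug p)
    (by
      intro x
      obtain ⟨n, rfl⟩ := ZMod.intCast_surjective x
      exact ⟨MvPolynomial.C n, by simp [q]⟩)
    (KoszulAux.seq_reg p hp)
    (by
      intro i x
      rw [hsmul, (KoszulAux.ker_aug p _).mpr ⟨i+1, Ideal.subset_span ⟨i, by simp, rfl⟩⟩, zero_mul])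
  refine ⟨?_, fun j hj => ?_⟩
  · obtain ⟨e⟩ := key 0
    have : Unique {S : Finset ℕ | S.card = 0} :=
      ⟨⟨⟨∅, by simp⟩⟩, fun S => Subtype.ext (Finset.card_eq_zero.mp S.2)⟩
    rw [Nat.card_congr e,
      Nat.card_congr (Finsupp.uniqueLinearEquiv ℤ (M := ZMod p) (default : {S : Finset ℕ | S.card = 0})).toEquiv]
    simp
  · obtain ⟨e⟩ := key j
    refine ⟨?_, ?_⟩
    · exact e.injective.countable
    · have : Infinite {S : Finset ℕ | S.card = j} := by
        refine Infinite.of_injective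
          (fun n : ℕ => (⟨(Finset.range j).image (fun i => n + i), by
            simp [Finset.card_image_of_injective _ (add_right_injective n)]⟩ : {S : Finset ℕ | S.card = j})) ?_
        intro n m h
        have h1 := congrArg Subtype.val h
        simp only at h1
        have h2 : n ∈ (Finset.range j).image (fun i => n + i) := 
          Finset.mem_image.mpr ⟨0, Finset.mem_range.mpr hj, by simp⟩
        have h3 : m ∈ (Finset.range j).image (fun i => m + i) := 
          Finset.mem_image.mpr ⟨0, Finset.mem_range.mpr hj, by simp⟩
        rw [h1] at h2
        rw [← h1] at h3
        simp only [Finset.mem_image] at h2 h3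
        obtain ⟨_, _, _⟩ := h2
        obtain ⟨_, _, _⟩ := h3
        omega
      have : Infinite ({S : Finset ℕ | S.card = j} →₀ ZMod p) :=
        Infinite.of_injective (fun S => Finsupp.single S 1)
          (Finsupp.single_left_injective one_ne_zero)
      exact Infinite.of_injective e.symm e.symm.injective
end
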